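/- Every valuation v ∈ Val(M_{S4}) assigns a designated value (1 or 2) to each of the following formulas, for all atoms p, q: □(p → q) → (□p → □q) (axiom k), □p → p (axiom t), and □p → □□p (axiom 4). -/

import Mathlib

/-- Modal formulas. -/
inductive MForm : Type where
  | atom : ℕ → MForm
  | bot : MForm
  | top : MForm
  | neg : MForm → MForm
  | box : MForm → MForm
  | imp : MForm → MForm → MForm
  | conj : MForm → MForm → MForm
  | disj : MForm → MForm → MForm
deriving DecidableEq

/-- Truth values of `M_{S4}`: `v0 = 0`, `v1 = 1`, `v2 = 2`; designated are `v1, v2`. -/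
inductive MVal : Type where
  | v0 : MVal
  | v1 : MVal
  | v2 : MVal
deriving DecidableEq

/-- Multifunction for negation. -/
def MNeg : MVal → Set MVal
  | MVal.v2 => {MVal.v0}
  | MVal.v1 => {MVal.v0}
  | MVal.v0 => {MVal.v1, MVal.v2}

/-- Multifunction for box. -/
def MBox : MVal → Set MVal
  | MVal.v2 => {MVal.v2}
  | MVal.v1 => {MVal.v0}
  | MVal.v0 => {MVal.v0}

/-- Multifunction for implication. -/
def MImp : MVal → MVal → Set MVal
  | MVal.v2, MVal.v2 => {MVal.v2}
  | MVal.v2, MVal.v1 => {MVal.v1}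
  | MVal.v2, MVal.v0 => {MVal.v0}
  | MVal.v1, MVal.v2 => {MVal.v2}
  | MVal.v1, MVal.v1 => {MVal.v1, MVal.v2}
  | MVal.v1, MVal.v0 => {MVal.v0}
  | MVal.v0, MVal.v2 => {MVal.v2}
  | MVal.v0, MVal.v1 => {MVal.v1, MVal.v2}
  | MVal.v0, MVal.v0 => {MVal.v1, MVal.v2}

/-- Conjunction is the minimum. -/
def MMin : MVal → MVal → MVal
  | MVal.v0, _ => MVal.v0
  | _, MVal.v0 => MVal.v0
  | MVal.v1, _ => MVal.v1
  | _, MVal.v1 => MVal.v1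
  | MVal.v2, MVal.v2 => MVal.v2

/-- Multifunction for disjunction. -/
def MDisj : MVal → MVal → Set MVal
  | MVal.v2, _ => {MVal.v2}
  | _, MVal.v2 => {MVal.v2}
  | MVal.v0, MVal.v0 => {MVal.v0}
  | _, _ => {MVal.v1, MVal.v2}

/-- `v ∈ Val(M_{S4})`. -/
def MIsVal (v : MForm → MVal) : Prop :=
  v MForm.bot = MVal.v0 ∧ v MForm.top = MVal.v2 ∧
  (∀ a, v (MForm.neg a) ∈ MNeg (v a)) ∧
  (∀ a, v (MForm.box a) ∈ MBox (v a)) ∧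
  (∀ a b, v (MForm.imp a b) ∈ MImp (v a) (v b)) ∧
  (∀ a b, v (MForm.conj a b) = MMin (v a) (v b)) ∧
  (∀ a b, v (MForm.disj a b) ∈ MDisj (v a) (v b))

/-- The levels `L_k` for `M_{S4}`. -/
def MLev : ℕ → Set (MForm → MVal)
  | 0 => {v | MIsVal v}
  | k + 1 => {v | v ∈ MLev k ∧
      ∀ a, v a = MVal.v1 →
        ∃ w ∈ MLev k, w a = MVal.v0 ∧ ∀ b, v b = MVal.v2 → w b = MVal.v2}

/-- `L^{S4} = ⋂_k L_k`. -/
def MLimit : Set (MForm → MVal) := {v | ∀ k, v ∈ MLev k}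

namespace MIsVal

variable {v : MForm → MVal}

theorem imp_ne_v0_iff (hv : MIsVal v) (a b : MForm) :
    v (MForm.imp a b) ≠ MVal.v0 ↔ (v a ≠ MVal.v0 → v b ≠ MVal.v0) := by
  have h := hv.2.2.2.2.1 a b
  cases ha : v a <;> cases hb : v b <;> cases hab : v (MForm.imp a b) <;>
    simp_all [MImp]

theorem eq_v2_of_imp_eq_v2 (hv : MIsVal v) {a b : MForm}
    (hab : v (MForm.imp a b) = MVal.v2) (ha : v a = MVal.v2) : v b = MVal.v2 := by
  have h := hv.2.2.2.2.1 a b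
  cases hb : v b <;> simp_all [MImp]

theorem box_ne_v0_iff (hv : MIsVal v) (a : MForm) :
    v (MForm.box a) ≠ MVal.v0 ↔ v a = MVal.v2 := by
  have h := hv.2.2.2.1 a
  cases ha : v a <;> simp_all [MBox]

theorem box_eq_v2 (hv : MIsVal v) {a : MForm} (ha : v a = MVal.v2) :
    v (MForm.box a) = MVal.v2 := by
  simpa [ha, MBox] using hv.2.2.2.1 a

end MIsVal

theorem S4_axioms_designated_in_MS4 (v : MForm → MVal) (hv : MIsVal v) (p q : ℕ) :
    v (MForm.imp (MForm.box (MForm.imp (MForm.atom p) (MForm.atom q)))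
        (MForm.imp (MForm.box (MForm.atom p)) (MForm.box (MForm.atom q)))) ≠ MVal.v0 ∧
    v (MForm.imp (MForm.box (MForm.atom p)) (MForm.atom p)) ≠ MVal.v0 ∧
    v (MForm.imp (MForm.box (MForm.atom p))
        (MForm.box (MForm.box (MForm.atom p)))) ≠ MVal.v0 := by
  simp only [hv.imp_ne_v0_iff, hv.box_ne_v0_iff]
  exact ⟨hv.eq_v2_of_imp_eq_v2, fun h => by simp [h], hv.box_eq_v2⟩
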